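/- Let f = e^{-ψ} be a nondegenerate integrable log-concave function on ℝⁿ and define ξ_f(s) = s · max{ det T : T ∈ S₊, T B₂ⁿ ⊆ G_f(s) } for 0 < s ≤ ‖f‖_∞. Then for all s₁, s₂ ∈ (0, ‖f‖_∞] and all 0 ≤ λ ≤ 1, ξ_f(s₁^{1−λ} s₂^{λ}) ≥ ξ_f(s₁)^{1−λ} · ξ_f(s₂)^{λ}. Moreover, lim_{s → 0⁺} ξ_f(s) = 0. -/

import Mathlib

open MeasureTheory Metric Set Filter

noncomputable section

abbrev En (n : ℕ) := EuclideanSpace ℝ (Fin n)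

def LogConcaveFn {n : ℕ} (f : En n → ℝ) : Prop :=
  (∀ x, 0 ≤ f x) ∧
  ∀ x y : En n, ∀ l : ℝ, 0 ≤ l → l ≤ 1 →
    f x ^ l * f y ^ (1 - l) ≤ f (l • x + (1 - l) • y)

/-- `ξ_f(s) = s · max{ det T : T ∈ S₊, T B₂ⁿ ⊆ G_f(s) }`. -/
def xiFn {n : ℕ} (f : En n → ℝ) (s : ℝ) : ℝ :=
  s * sSup {d : ℝ | ∃ T : Matrix (Fin n) (Fin n) ℝ, T.PosDef ∧
    Matrix.toEuclideanLin T '' closedBall (0 : En n) 1 ⊆ {x | s ≤ f x} ∧ d = T.det}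

open scoped MatrixOrder Matrix.Norms.L2Operator in
/-- A positive definite matrix can be written as `Sᴴ * S` with `S` invertible. -/
theorem Matrix.PosDef.exists_isUnit_eq_star_mul_self {ι : Type*} [Fintype ι] [DecidableEq ι]
    {A : Matrix ι ι ℝ} (hA : A.PosDef) : ∃ S : Matrix ι ι ℝ, IsUnit S ∧ A = star S * S :=
  CStarAlgebra.isStrictlyPositive_iff_eq_star_mul_self.mp
    (Matrix.isStrictlyPositive_iff_posDef.mpr hA)

/-- `det (a • 1 + b • C)` in terms of the eigenvalues of the Hermitian matrix `C`. -/
theorem Matrix.IsHermitian.det_smul_one_add_smul {ι : Type*} [Fintype ι] [DecidableEq ι]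
    {C : Matrix ι ι ℝ} (hC : C.IsHermitian) (a b : ℝ) :
    (a • (1 : Matrix ι ι ℝ) + b • C).det = ∏ i, (a + b * hC.eigenvalues i) := by
  have hdiag : a • (1 : Matrix ι ι ℝ) + b • Matrix.diagonal hC.eigenvalues =
      Matrix.diagonal fun i => a + b * hC.eigenvalues i := by
    ext i j
    by_cases h : i = j
    · subst h; simp
    · simp [h]
  have hspec : a • (1 : Matrix ι ι ℝ) + b • C =
      Unitary.conjStarAlgAut ℝ _ hC.eigenvectorUnitary
        (Matrix.diagonal fun i => a + b * hC.eigenvalues i) := by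
    conv_lhs => rw [hC.spectral_theorem]
    rw [← hdiag, map_add, map_smul, map_smul, map_one]
    rfl
  rw [hspec, Unitary.conjStarAlgAut_apply, Matrix.det_mul_right_comm, ← Matrix.det_diagonal]
  simp

/-- The determinant is log-concave on positive definite matrices. -/
theorem Matrix.PosDef.det_rpow_mul_det_rpow_le {ι : Type*} [Fintype ι] [DecidableEq ι]
    {A B : Matrix ι ι ℝ} (hA : A.PosDef) (hB : B.PosDef) {a b : ℝ} (ha : 0 ≤ a) (hb : 0 ≤ b)
    (hab : a + b = 1) : A.det ^ a * B.det ^ b ≤ (a • A + b • B).det := by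
  obtain ⟨S, hS, rfl⟩ := hA.exists_isUnit_eq_star_mul_self
  have hSd : IsUnit S.det := (Matrix.isUnit_iff_isUnit_det S).mp hS
  have hSi : IsUnit S⁻¹ := (Matrix.isUnit_nonsing_inv_iff).mpr hS
  have hC : (star S⁻¹ * B * S⁻¹).PosDef := (Matrix.IsUnit.posDef_star_left_conjugate_iff hSi).mpr hB
  set C := star S⁻¹ * B * S⁻¹ with hCdef
  have hBC : B = star S * C * S := by
    have h1 : S⁻¹ * S = 1 := Matrix.nonsing_inv_mul S hSd
    have h2 : star S * star S⁻¹ = 1 := by rw [← star_mul, h1, star_one]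
    calc B = (star S * star S⁻¹) * B * (S⁻¹ * S) := by rw [h1, h2, one_mul, mul_one]
      _ = star S * C * S := by rw [hCdef]; simp only [mul_assoc]
  have hsum : a • (star S * S) + b • B = star S * (a • (1 : Matrix ι ι ℝ) + b • C) * S := by
    rw [hBC]
    simp [mul_add, add_mul]
  have hstar : (star S).det = S.det := by simp [Matrix.star_eq_conjTranspose]
  have hd : 0 < S.det * S.det := mul_self_pos.mpr hSd.ne_zero
  have hev : ∀ i, 0 < hC.1.eigenvalues i := hC.eigenvalues_pos
  have hdetC : C.det = ∏ i, hC.1.eigenvalues i := by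
    simpa using hC.1.det_eq_prod_eigenvalues
  have hdetB : B.det = (S.det * S.det) * C.det := by
    rw [hBC, Matrix.det_mul, Matrix.det_mul, hstar]; ring
  have hprod : C.det ^ b ≤ (a • (1 : Matrix ι ι ℝ) + b • C).det := by
    rw [hC.1.det_smul_one_add_smul, hdetC,
      ← Real.finsetProd_rpow _ _ fun i _ => (hev i).le]
    refine Finset.prod_le_prod (fun i _ => Real.rpow_nonneg (hev i).le _) fun i _ => ?_
    simpa using Real.geom_mean_le_arith_mean2_weighted ha hb zero_le_one (hev i).le hab
  rw [hsum, Matrix.det_mul, Matrix.det_mul, Matrix.det_mul, hstar, hdetB,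
    Real.mul_rpow hd.le hC.det_pos.le, ← mul_assoc, ← Real.rpow_add hd, hab, Real.rpow_one]
  calc S.det * S.det * C.det ^ b
      ≤ S.det * S.det * (a • (1 : Matrix ι ι ℝ) + b • C).det := by gcongr
    _ = S.det * (a • (1 : Matrix ι ι ℝ) + b • C).det * S.det := by ring

/-- If `a ^ p * b ^ q ≤ c` on nonempty sets, the same bound holds for the suprema. -/
theorem sSup_rpow_mul_sSup_rpow_le {A B : Set ℝ} (hA : A.Nonempty) (hB : B.Nonempty)
    (hA' : BddAbove A) (hB' : BddAbove B) {p q c : ℝ} (hp : 0 ≤ p) (hq : 0 ≤ q)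
    (h : ∀ a ∈ A, ∀ b ∈ B, a ^ p * b ^ q ≤ c) : sSup A ^ p * sSup B ^ q ≤ c := by
  have h1 : ∀ a ∈ A, a ^ p * sSup B ^ q ≤ c := fun a ha =>
    closure_minimal (t := {b | a ^ p * b ^ q ≤ c}) (fun b hb => h a ha b hb)
      (isClosed_le (continuous_const.mul (Real.continuous_rpow_const hq)) continuous_const)
      (csSup_mem_closure hB hB')
  exact closure_minimal (t := {a | a ^ p * sSup B ^ q ≤ c}) h1
      (isClosed_le ((Real.continuous_rpow_const hp).mul continuous_const) continuous_const)
      (csSup_mem_closure hA hA')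

/-- The determinants of the centred ellipsoids contained in the super-level set `{x | s ≤ f x}`. -/
def ellipsoidDets {n : ℕ} (f : En n → ℝ) (s : ℝ) : Set ℝ :=
  {d : ℝ | ∃ T : Matrix (Fin n) (Fin n) ℝ, T.PosDef ∧
    Matrix.toEuclideanLin T '' closedBall (0 : En n) 1 ⊆ {x | s ≤ f x} ∧ d = T.det}

theorem xiFn_eq {n : ℕ} (f : En n → ℝ) (s : ℝ) : xiFn f s = s * sSup (ellipsoidDets f s) := rfl

theorem nonneg_of_mem_ellipsoidDets {n : ℕ} {f : En n → ℝ} {s d : ℝ}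
    (hd : d ∈ ellipsoidDets f s) : 0 ≤ d := by
  obtain ⟨T, hT, -, rfl⟩ := hd
  exact hT.det_pos.le

theorem sSup_ellipsoidDets_nonneg {n : ℕ} (f : En n → ℝ) (s : ℝ) :
    0 ≤ sSup (ellipsoidDets f s) :=
  Real.sSup_nonneg fun _ => nonneg_of_mem_ellipsoidDets

theorem xiFn_nonneg {n : ℕ} (f : En n → ℝ) {s : ℝ} (hs : 0 ≤ s) : 0 ≤ xiFn f s :=
  mul_nonneg hs (sSup_ellipsoidDets_nonneg f s)

theorem measure_superlevel_ne_top {n : ℕ} {f : En n → ℝ} (hint : Integrable f) {s : ℝ}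
    (hs : 0 < s) : volume {x | s ≤ f x} ≠ ⊤ :=
  (lt_of_le_of_lt (measure_mono fun x hx => le_trans hx (Real.le_norm_self (f x)))
    (hint.measure_norm_ge_lt_top hs)).ne

theorem volume_real_closedBall_pos (n : ℕ) : 0 < volume.real (closedBall (0 : En n) 1) :=
  ENNReal.toReal_pos (measure_closedBall_pos _ _ one_pos).ne' measure_closedBall_lt_top.ne

theorem le_volume_div_of_mem_ellipsoidDets {n : ℕ} {f : En n → ℝ} (hint : Integrable f) {s d : ℝ}
    (hs : 0 < s) (hd : d ∈ ellipsoidDets f s) :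
    d ≤ volume.real {x | s ≤ f x} / volume.real (closedBall (0 : En n) 1) := by
  obtain ⟨T, hT, hsub, rfl⟩ := hd
  rw [le_div_iff₀ (volume_real_closedBall_pos n)]
  have h := measureReal_mono (μ := volume) hsub (measure_superlevel_ne_top hint hs)
  rwa [measureReal_def, Measure.addHaar_image_linearMap, ENNReal.toReal_mul,
    LinearMap.det_toLpLin, abs_of_pos hT.det_pos, ENNReal.toReal_ofReal hT.det_pos.le] at h

theorem bddAbove_ellipsoidDets {n : ℕ} {f : En n → ℝ} (hint : Integrable f) {s : ℝ}
    (hs : 0 < s) : BddAbove (ellipsoidDets f s) :=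
  ⟨_, fun _ => le_volume_div_of_mem_ellipsoidDets hint hs⟩

theorem xiFn_le_volume_div {n : ℕ} {f : En n → ℝ} (hint : Integrable f) {s : ℝ} (hs : 0 < s) :
    xiFn f s ≤ s * volume.real {x | s ≤ f x} / volume.real (closedBall (0 : En n) 1) := by
  rw [xiFn_eq, mul_div_assoc]
  refine mul_le_mul_of_nonneg_left (Real.sSup_le ?_ (by positivity)) hs.le
  exact fun d => le_volume_div_of_mem_ellipsoidDets hint hs

/-- For an integrable function `f`, `s * μ {x | s ≤ f x} → 0` as `s → 0⁺`. -/
theorem MeasureTheory.Integrable.tendsto_mul_measureReal_superlevel {α : Type*} [MeasurableSpace α]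
    {μ : Measure α} {f : α → ℝ} (hint : Integrable f μ) :
    Tendsto (fun s : ℝ => s * μ.real {x | s ≤ f x}) (nhdsWithin 0 (Ioi 0)) (nhds 0) := by
  have hmeas : ∀ s : ℝ, NullMeasurableSet {x | s ≤ f x} μ := fun s =>
    nullMeasurableSet_le aemeasurable_const hint.aemeasurable
  have hlim : Tendsto (fun s : ℝ => ∫ x, {x | s ≤ f x}.indicator (fun _ => s) x ∂μ)
      (nhdsWithin 0 (Ioi 0)) (nhds (∫ _, (0 : ℝ) ∂μ)) := by
    refine tendsto_integral_filter_of_dominated_convergence (fun x => ‖f x‖) ?_ ?_ hint.norm ?_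
    · exact Eventually.of_forall fun s =>
        (aestronglyMeasurable_const (b := s)).indicator₀ (hmeas s)
    · filter_upwards [self_mem_nhdsWithin] with s hs
      refine Eventually.of_forall fun x => ?_
      by_cases hx : s ≤ f x
      · rw [indicator_of_mem (show x ∈ {x | s ≤ f x} from hx), Real.norm_of_nonneg (le_of_lt hs)]
        exact hx.trans (Real.le_norm_self _)
      · rw [indicator_of_notMem (show x ∉ {x | s ≤ f x} from hx), norm_zero]
        exact norm_nonneg _
    · refine Eventually.of_forall fun x => ?_
      have hid : Tendsto (fun s : ℝ => s) (nhdsWithin 0 (Ioi 0)) (nhds 0) :=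
        tendsto_id.mono_left nhdsWithin_le_nhds
      refine tendsto_of_tendsto_of_tendsto_of_le_of_le' tendsto_const_nhds hid ?_ ?_
      · filter_upwards [self_mem_nhdsWithin] with s hs
        exact indicator_nonneg (fun _ _ => le_of_lt hs) x
      · filter_upwards [self_mem_nhdsWithin] with s hs
        exact indicator_le_self' (fun _ _ => le_of_lt hs) x
  rw [integral_zero] at hlim
  refine hlim.congr fun s => ?_
  rw [integral_indicator₀ (hmeas s), setIntegral_const, smul_eq_mul, mul_comm]

/-- Convex combinations of matrices of contained ellipsoids give contained ellipsoids. -/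
theorem det_mem_ellipsoidDets_of_logConcave {n : ℕ} {f : En n → ℝ} (hlc : LogConcaveFn f)
    {s₁ s₂ l : ℝ} (hs₁ : 0 < s₁) (hs₂ : 0 < s₂) (hl0 : 0 < l) (hl1 : l < 1)
    {T₁ T₂ : Matrix (Fin n) (Fin n) ℝ} (hT₁ : T₁.PosDef) (hT₂ : T₂.PosDef)
    (h₁ : Matrix.toEuclideanLin T₁ '' closedBall (0 : En n) 1 ⊆ {x | s₁ ≤ f x})
    (h₂ : Matrix.toEuclideanLin T₂ '' closedBall (0 : En n) 1 ⊆ {x | s₂ ≤ f x}) :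
    ((1 - l) • T₁ + l • T₂).det ∈ ellipsoidDets f (s₁ ^ (1 - l) * s₂ ^ l) := by
  have hl1' : 0 < 1 - l := sub_pos.mpr hl1
  refine ⟨_, (hT₁.smul hl1').add (hT₂.smul hl0), ?_, rfl⟩
  rintro _ ⟨x, hx, rfl⟩
  have e₁ : s₁ ≤ f (Matrix.toEuclideanLin T₁ x) := h₁ ⟨x, hx, rfl⟩
  have e₂ : s₂ ≤ f (Matrix.toEuclideanLin T₂ x) := h₂ ⟨x, hx, rfl⟩
  have hf := hlc.2 (Matrix.toEuclideanLin T₁ x) (Matrix.toEuclideanLin T₂ x) (1 - l) hl1'.le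
    (by linarith)
  rw [sub_sub_cancel] at hf
  change _ ≤ f _
  rw [map_add, map_smul, map_smul, LinearMap.add_apply, LinearMap.smul_apply, LinearMap.smul_apply]
  refine le_trans ?_ hf
  exact mul_le_mul (Real.rpow_le_rpow hs₁.le e₁ hl1'.le) (Real.rpow_le_rpow hs₂.le e₂ hl0.le)
    (Real.rpow_nonneg hs₂.le _) (Real.rpow_nonneg (hlc.1 _) _)

theorem xiFn_rpow_mul_xiFn_rpow_le {n : ℕ} {f : En n → ℝ} (hlc : LogConcaveFn f)
    (hint : Integrable f) {s₁ s₂ l : ℝ} (hs₁ : 0 < s₁) (hs₂ : 0 < s₂) (hl0 : 0 ≤ l) (hl1 : l ≤ 1) :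
    xiFn f s₁ ^ (1 - l) * xiFn f s₂ ^ l ≤ xiFn f (s₁ ^ (1 - l) * s₂ ^ l) := by
  rcases hl0.eq_or_lt with rfl | hl0
  · simp
  rcases hl1.eq_or_lt with rfl | hl1
  · simp
  have hl1' : 0 < 1 - l := sub_pos.mpr hl1
  have hs : 0 < s₁ ^ (1 - l) * s₂ ^ l :=
    mul_pos (Real.rpow_pos_of_pos hs₁ _) (Real.rpow_pos_of_pos hs₂ _)
  rcases (ellipsoidDets f s₁).eq_empty_or_nonempty with hE | hA
  · rw [xiFn_eq f s₁, hE, Real.sSup_empty, mul_zero, Real.zero_rpow hl1'.ne', zero_mul]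
    exact xiFn_nonneg f hs.le
  rcases (ellipsoidDets f s₂).eq_empty_or_nonempty with hE | hB
  · rw [xiFn_eq f s₂, hE, Real.sSup_empty, mul_zero, Real.zero_rpow hl0.ne', mul_zero]
    exact xiFn_nonneg f hs.le
  rw [xiFn_eq, xiFn_eq, xiFn_eq, Real.mul_rpow hs₁.le (sSup_ellipsoidDets_nonneg f s₁),
    Real.mul_rpow hs₂.le (sSup_ellipsoidDets_nonneg f s₂), mul_mul_mul_comm]
  refine mul_le_mul_of_nonneg_left ?_ hs.le
  refine sSup_rpow_mul_sSup_rpow_le hA hB (bddAbove_ellipsoidDets hint hs₁)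
    (bddAbove_ellipsoidDets hint hs₂) hl1'.le hl0.le ?_
  rintro _ ⟨T₁, hT₁, h₁, rfl⟩ _ ⟨T₂, hT₂, h₂, rfl⟩
  exact (hT₁.det_rpow_mul_det_rpow_le hT₂ hl1'.le hl0.le (sub_add_cancel 1 l)).trans
    (le_csSup (bddAbove_ellipsoidDets hint hs)
      (det_mem_ellipsoidDets_of_logConcave hlc hs₁ hs₂ hl0 hl1 hT₁ hT₂ h₁ h₂))

theorem tendsto_xiFn_zero {n : ℕ} {f : En n → ℝ} (hint : Integrable f) :
    Tendsto (xiFn f) (nhdsWithin 0 (Ioi 0)) (nhds 0) := by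
  have h := hint.tendsto_mul_measureReal_superlevel.div_const
    (volume.real (closedBall (0 : En n) 1))
  rw [zero_div] at h
  refine tendsto_of_tendsto_of_tendsto_of_le_of_le' tendsto_const_nhds h ?_ ?_
  · filter_upwards [self_mem_nhdsWithin] with s hs
    exact xiFn_nonneg f (le_of_lt hs)
  · filter_upwards [self_mem_nhdsWithin] with s hs
    exact xiFn_le_volume_div hint hs

/-- `ξ_f` is multiplicatively concave:
`ξ_f(s₁^{1-λ}s₂^λ) ≥ ξ_f(s₁)^{1-λ} ξ_f(s₂)^λ`, and `ξ_f(s) → 0` as `s → 0⁺`. -/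
theorem xi_log_concave_and_tendsto_zero {n : ℕ}
    (f : En n → ℝ)
    (hlc : LogConcaveFn f)
    (hint : Integrable f)
    (hnd : (interior {x | 0 < f x}).Nonempty) :
    (∀ s₁ s₂ l : ℝ, s₁ ∈ Set.Ioc 0 (sSup (Set.range f)) →
      s₂ ∈ Set.Ioc 0 (sSup (Set.range f)) → 0 ≤ l → l ≤ 1 →
      xiFn f s₁ ^ (1 - l) * xiFn f s₂ ^ l ≤ xiFn f (s₁ ^ (1 - l) * s₂ ^ l)) ∧
    Tendsto (xiFn f) (nhdsWithin 0 (Set.Ioi 0)) (nhds 0) := by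
  exact ⟨fun s₁ s₂ l hs₁ hs₂ hl0 hl1 =>
    xiFn_rpow_mul_xiFn_rpow_le hlc hint hs₁.1 hs₂.1 hl0 hl1, tendsto_xiFn_zero hint⟩
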